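/- arXiv:1607.03969 — 2 statements merged into one kernel-verified Lean document; each statement's English description precedes it below -/
import Mathlib

section
/- Let p be any bivariate polynomial over ℂ of total degree n ≥ 1. Then there exist matrices A, B, C ∈ ℂ^{n×n} such that det(A + xB + yC) = p(x,y) as an identity of bivariate polynomials. -/
open Polynomial

section
variable {R : Type*} [CommRing R]

/-- The leading principal minor of order `n` of an infinite matrix. -/
def leadingMinor (M : ℕ → ℕ → R) (n : ℕ) : R :=
  (Matrix.of fun i j : Fin n => M i j).det

/-- Expansion along the last row of an upper Hessenberg matrix whose last column is replaced. -/
theorem det_hessenberg_updateCol (M : ℕ → ℕ → R) (v : R)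
    (hsub : ∀ k, M (k + 1) k = -v) (hzero : ∀ i k, k + 1 < i → M i k = 0) (c : ℕ → R) (k : ℕ) :
    (Matrix.of fun i j : Fin (k + 1) => if (j : ℕ) = k then c i else M i j).det =
      ∑ l ∈ Finset.range (k + 1),
        c (k - l) * v ^ l * leadingMinor M (k - l) := by
  induction k with
  | zero => simp [leadingMinor]
  | succ k ih =>
    rw [Matrix.det_succ_row _ (Fin.last (k + 1)), Fin.sum_univ_castSucc, Fin.sum_univ_castSucc,
      Finset.sum_range_succ']
    rw [Finset.sum_eq_zero]
    · have h1 : ((Matrix.of fun i j : Fin (k + 1 + 1) =>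
          if (j : ℕ) = k + 1 then c i else M i j).submatrix (Fin.last (k + 1)).succAbove
          (Fin.last k).castSucc.succAbove) =
          Matrix.of fun i j : Fin (k + 1) => if (j : ℕ) = k then c i else M i j := by
        ext i j
        rcases Fin.eq_castSucc_or_eq_last j with ⟨j, rfl⟩ | rfl
        · have h : (Fin.last k).castSucc.succAbove j.castSucc = j.castSucc.castSucc := by
            rw [Fin.succAbove_of_castSucc_lt]
            simp [Fin.lt_def]
          simp [h, j.2.ne, (j.2.trans (Nat.lt_succ_self k)).ne]
        · have h : (Fin.last k).castSucc.succAbove (Fin.last k) = Fin.last (k + 1) := by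
            rw [Fin.succAbove_of_le_castSucc] <;> simp
          simp [h]
      have h2 : ((Matrix.of fun i j : Fin (k + 1 + 1) =>
          if (j : ℕ) = k + 1 then c i else M i j).submatrix (Fin.last (k + 1)).succAbove
          (Fin.last (k + 1)).succAbove) = Matrix.of fun i j : Fin (k + 1) => M i j := by
        ext i j
        simp [j.2.ne]
      rw [h1, h2, ih, ← leadingMinor]
      have h3 : ((-1 : R)) ^ (k + 1 + k) = -1 := Odd.neg_one_pow ⟨k, by ring⟩
      have h4 : ((-1 : R)) ^ (k + 1 + (k + 1)) = 1 := Even.neg_one_pow ⟨k + 1, by ring⟩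
      simp [hsub, h3, h4, Finset.mul_sum, pow_succ]
      refine Finset.sum_congr rfl fun l _ => ?_
      ring
    · intro j _
      have hj : (j : ℕ) ≠ k + 1 := (j.2.trans (by omega)).ne
      simp [hzero (k + 1) j (by omega), hj]

/-- The leading principal minors of an upper Hessenberg matrix satisfy a full-history recurrence. -/
theorem det_hessenberg_succ (M : ℕ → ℕ → R) (v : R)
    (hsub : ∀ k, M (k + 1) k = -v) (hzero : ∀ i k, k + 1 < i → M i k = 0) (k : ℕ) :
    leadingMinor M (k + 1) =
      ∑ l ∈ Finset.range (k + 1), M (k - l) k * v ^ l * leadingMinor M (k - l) := by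
  rw [← det_hessenberg_updateCol M v hsub hzero fun i => M i k, leadingMinor]
  congr 1
  ext i j
  by_cases h : (j : ℕ) = k <;> simp [h]

end

section
variable {K : Type*} [Field K]

/-- One step of the triangular solve: coefficients of a fixed power of the second variable. -/
theorem exists_newton_chain (r : ℕ → K) (s n : ℕ)
    (hr : Set.InjOn r (Set.Iio n)) (g : ℕ → K[X])
    (hg : ∀ k < n, (g k).degree < (k + 1 - s : ℕ)) (q : K[X]) (hq : q.degree < (n - s : ℕ)) :
    ∃ (f : ℕ → K[X]) (β : ℕ → K), f n = q ∧ (∀ k ≤ n, (f k).degree < (k - s : ℕ)) ∧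
      (∀ k < s, β k = 0) ∧
      ∀ k < n, f (k + 1) = (X - C (r k)) * f k + g k +
        C (β k) * ∏ t ∈ Finset.range (k - s), (X - C (r t)) := by
  induction n generalizing q with
  | zero => exact ⟨fun _ => q, 0, rfl, by simpa using hq, by simp, by simp⟩
  | succ n ih =>
    obtain ⟨b, p, hb, hp, hqp⟩ : ∃ (b : K) (p : K[X]), (n < s → b = 0) ∧
        p.degree < (n - s : ℕ) ∧
        q = (X - C (r n)) * p + g n + C b * ∏ t ∈ Finset.range (n - s), (X - C (r t)) := by
      have hgn := hg n (Nat.lt_succ_self n)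
      rcases lt_or_ge n s with h | h
      · have hz : n + 1 - s = 0 := by omega
        rw [hz, Nat.cast_zero, ← not_le, zero_le_degree_iff, not_not] at hq hgn
        exact ⟨0, 0, fun _ => rfl, by simp, by simp [hq, hgn]⟩
      · set w := ∏ t ∈ Finset.range (n - s), (X - C (r t)) with hw
        have hw0 : w.eval (r n) ≠ 0 := by
          rw [hw, eval_prod, Finset.prod_ne_zero_iff]
          intro t ht
          rw [Finset.mem_range] at ht
          rw [eval_sub, eval_X, eval_C, sub_ne_zero]
          intro he
          have := hr (by simp) (by simp; omega) he
          omega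
        have hwd : w.degree < (n + 1 - s : ℕ) := by
          rw [hw, degree_prod]
          simp
          omega
        set b := (q - g n).eval (r n) / w.eval (r n) with hbdef
        have hroot : (q - g n - C b * w).IsRoot (r n) := by
          simp [IsRoot, hbdef, hw0]
        obtain ⟨p, hp⟩ := dvd_iff_isRoot.mpr hroot
        refine ⟨b, p, fun h' => absurd h' (not_lt.mpr h), ?_, by linear_combination hp⟩
        have hd : (q - g n - C b * w).degree < (n + 1 - s : ℕ) := by
          rw [← smul_eq_C_mul]
          exact (degree_sub_le _ _).trans_lt (max_lt ((degree_sub_le _ _).trans_lt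
            (max_lt hq hgn)) ((degree_smul_le b w).trans_lt hwd))
        rw [hp, degree_mul, degree_X_sub_C] at hd
        rcases eq_or_ne p 0 with rfl | hp0
        · simp
        · rw [degree_eq_natDegree hp0] at hd ⊢
          norm_cast at hd ⊢
          omega
    obtain ⟨f, β, hfn, hfd, hβ, hrec⟩ := ih (hr.mono (Set.Iio_subset_Iio (Nat.le_succ n)))
      (fun k hk => hg k (hk.trans (Nat.lt_succ_self n))) p hp
    refine ⟨Function.update f (n + 1) q, Function.update β n b, by simp, fun k hk => ?_,
      fun k hk => ?_, fun k hk => ?_⟩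
    · rcases hk.lt_or_eq with h | rfl
      · rw [Function.update_of_ne h.ne]
        exact hfd k (Nat.lt_succ_iff.mp h)
      · simpa using hq
    · rcases eq_or_ne k n with rfl | h
      · simpa using hb hk
      · simpa [h] using hβ k hk
    · rcases (Nat.lt_succ_iff.mp hk).lt_or_eq with h | rfl
      · rw [Function.update_of_ne (by omega), Function.update_of_ne (by omega),
          Function.update_of_ne (by omega), hrec k h]
      · simp [hqp, hfn]

/-- The triangular solve, for the first `N` powers of the second variable. -/
theorem exists_hessenberg_coeffs_aux (r : ℕ → K) (n : ℕ) (hr : Set.InjOn r (Set.Iio n))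
    (q : ℕ → K[X]) (hq0 : q 0 = ∏ t ∈ Finset.range n, (X - C (r t)))
    (hq : ∀ m, (q m).degree < (n + 1 - m : ℕ)) (N : ℕ) :
    ∃ (f : ℕ → ℕ → K[X]) (b : ℕ → ℕ → K), (∀ k l, k < l → b k l = 0) ∧
      ∀ m < N, f m n = q m ∧ (∀ k ≤ n, (f m k).degree < (k + 1 - m : ℕ)) ∧
        (m = 0 → ∀ k ≤ n, f m k = ∏ t ∈ Finset.range k, (X - C (r t))) ∧
        ∀ k < n, f m (k + 1) = (X - C (r k)) * f m k +
          ∑ l ∈ Finset.range m, C (b k l) * f (m - (l + 1)) (k - l) := by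
  induction N with
  | zero => exact ⟨0, 0, by simp, by simp⟩
  | succ N ih =>
    obtain ⟨f, b, hb, hf⟩ := ih
    rcases N with _ | s
    · refine ⟨fun _ k => ∏ t ∈ Finset.range k, (X - C (r t)), b, hb, fun m hm => ?_⟩
      obtain rfl : m = 0 := by omega
      refine ⟨hq0.symm, fun k _ => ?_, fun _ k _ => rfl, fun k _ => ?_⟩
      · rw [degree_prod]
        simp
        norm_cast
        omega
      · simp [Finset.prod_range_succ, mul_comm]
    · obtain ⟨f', β, hfn, hfd, hβ, hrec⟩ := exists_newton_chain r s n hr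
        (fun k => ∑ l ∈ Finset.range s, C (b k l) * f (s - l) (k - l))
        (fun k hk => by
          refine (degree_sum_le _ _).trans_lt ((Finset.sup_lt_iff ?_).2 fun l hl => ?_)
          · exact WithBot.bot_lt_coe _
          · rw [Finset.mem_range] at hl
            rcases lt_or_ge k l with h | h
            · simp [hb k l h]
            · rw [← smul_eq_C_mul]
              refine (degree_smul_le _ _).trans_lt
                (((hf (s - l) (by omega)).2.1 (k - l) (by omega)).trans_le ?_)
              norm_cast
              omega)
        (q (s + 1)) (by simpa using hq (s + 1))
      refine ⟨Function.update f (s + 1) f',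
        fun k l => if l = s then β k else b k l, fun k l hkl => ?_, fun m hm => ?_⟩
      · dsimp only
        split_ifs with h
        · exact hβ k (h ▸ hkl)
        · exact hb k l hkl
      · rcases (Nat.lt_succ_iff.mp hm).lt_or_eq with h | rfl
        · rw [Function.update_of_ne h.ne]
          obtain ⟨h1, h2, h3, h4⟩ := hf m h
          refine ⟨h1, h2, h3, fun k hk => ?_⟩
          rw [h4 k hk]
          congr 1
          refine Finset.sum_congr rfl fun l hl => ?_
          rw [Finset.mem_range] at hl
          rw [Function.update_of_ne (by omega)]
          dsimp only
          rw [if_neg (by omega)]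
        · rw [Function.update_self]
          refine ⟨hfn, fun k hk => by simpa using hfd k hk, by simp, fun k hk => ?_⟩
          rw [hrec k hk, Finset.sum_range_succ, ← add_assoc]
          dsimp only
          rw [if_pos rfl]
          congr 2
          · refine Finset.sum_congr rfl fun l hl => ?_
            rw [Finset.mem_range] at hl
            rw [Function.update_of_ne (by omega), if_neg (by omega)]
            congr 2
            omega
          · rw [Nat.sub_self, Function.update_of_ne (by omega),
              (hf 0 (by omega)).2.2.1 rfl (k - s) (by omega)]

/-- Every bivariate polynomial of degree at most `n` (in the sense of `hq`) restricting to
`∏ (x - r t)` on `y = 0`, with distinct `r t`, is the last term of a recurrence of Hessenberg type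
with constant coefficients. -/
theorem exists_hessenberg_coeffs (r : ℕ → K) (n : ℕ) (hr : Set.InjOn r (Set.Iio n))
    (q : K[X][X]) (hq0 : q.coeff 0 = ∏ t ∈ Finset.range n, (X - C (r t)))
    (hq : ∀ m, (q.coeff m).degree < (n + 1 - m : ℕ)) :
    ∃ (F : ℕ → K[X][X]) (b : ℕ → ℕ → K), F 0 = 1 ∧ F n = q ∧
      ∀ k < n, F (k + 1) = C (X - C (r k)) * F k +
        ∑ l ∈ Finset.range (k + 1), C (C (b k l)) * X ^ (l + 1) * F (k - l) := by
  obtain ⟨f, b, hb, hf⟩ := exists_hessenberg_coeffs_aux r n hr q.coeff hq0 hq (n + 1)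
  let F : ℕ → K[X][X] := fun k => ∑ m ∈ Finset.range (n + 1), C (f m k) * X ^ m
  have hF : ∀ k m, m < n + 1 → (F k).coeff m = f m k := by
    intro k m hm
    simp [F, finsetSum_coeff, coeff_X_pow, hm]
  have hF0 : ∀ k ≤ n, ∀ m, k < m → (F k).coeff m = 0 := by
    intro k hk m hm
    rcases lt_or_ge m (n + 1) with h | h
    · have := (hf m h).2.1 k hk
      rw [hF k m h]
      have hz : k + 1 - m = 0 := by omega
      rwa [hz, Nat.cast_zero, ← not_le, zero_le_degree_iff, not_not] at this
    · simp [F, finsetSum_coeff, coeff_X_pow]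
      intro h'; omega
  clear_value F
  refine ⟨F, b, ?_, ?_, fun k hk => ?_⟩
  · ext1 m
    rcases m with _ | m
    · rw [hF 0 0 (by omega), (hf 0 (by omega)).2.2.1 rfl 0 (by omega)]
      simp
    · rw [hF0 0 (by omega) _ (by omega)]
      simp [coeff_one]
  · ext1 m
    rcases lt_or_ge m (n + 1) with h | h
    · rw [hF n m h, (hf m h).1]
    · rw [hF0 n le_rfl m (by omega)]
      have := hq m
      have hz : n + 1 - m = 0 := by omega
      rw [hz, Nat.cast_zero, ← not_le, zero_le_degree_iff, not_not] at this
      exact this.symm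
  · ext1 m
    have hterm : ∀ l, (C (C (b k l)) * X ^ (l + 1) * F (k - l)).coeff m =
        if l + 1 ≤ m then C (b k l) * (F (k - l)).coeff (m - (l + 1)) else 0 := by
      intro l
      rw [mul_assoc, coeff_C_mul, coeff_X_pow_mul']
      split_ifs <;> simp
    rw [coeff_add, coeff_C_mul, finsetSum_coeff]
    rw [Finset.sum_congr rfl fun l _ => hterm l]
    rcases lt_or_ge m (n + 1) with h | h
    · rw [hF _ m h, hF _ m h, (hf m h).2.2.2 k hk]
      congr 1
      have e1 : ∑ l ∈ Finset.range m, C (b k l) * f (m - (l + 1)) (k - l) =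
          ∑ l ∈ Finset.range (m + (k + 1)),
            if l + 1 ≤ m then C (b k l) * (F (k - l)).coeff (m - (l + 1)) else 0 := by
        rw [Finset.sum_range_add, Finset.sum_congr rfl, left_eq_add]
        · exact Finset.sum_eq_zero fun l _ => if_neg (by omega)
        · intro l hl
          rw [Finset.mem_range] at hl
          rw [if_pos (by omega), hF _ _ (by omega)]
      rw [e1, add_comm m, Finset.sum_range_add, add_eq_left]
      refine Finset.sum_eq_zero fun l _ => ?_
      rw [hb _ _ (by omega)]
      simp
    · rw [hF0 _ hk m (by omega), hF0 _ hk.le m (by omega), Finset.sum_eq_zero]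
      · simp
      · intro l hl
        rw [Finset.mem_range] at hl
        split_ifs
        · rw [hF0 _ (by omega) _ (by omega), mul_zero]
        · rfl

/-- A determinantal representation of a polynomial whose restriction to `y = 0` has
simple roots. -/
theorem exists_det_eq_of_coeff_zero_eq_prod (r : ℕ → K) (n : ℕ) (hr : Set.InjOn r (Set.Iio n))
    (q : K[X][X]) (hq0 : q.coeff 0 = ∏ t ∈ Finset.range n, (X - C (r t)))
    (hq : ∀ m, (q.coeff m).degree < (n + 1 - m : ℕ)) :
    ∃ A : Matrix (Fin n) (Fin n) K,
      (Matrix.of fun i j : Fin n =>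
        (if i = j then C (X - C (r i)) else 0) + X * C (C (A i j))).det = q := by
  obtain ⟨F, b, hF0, hFn, hrec⟩ := exists_hessenberg_coeffs r n hr q hq0 hq
  let a : ℕ → ℕ → K := fun i k => if i ≤ k then b k (k - i) else if i = k + 1 then -1 else 0
  let M : ℕ → ℕ → K[X][X] := fun i k =>
    (if i = k then C (X - C (r i)) else 0) + X * C (C (a i k))
  have hsub : ∀ k, M (k + 1) k = -X := fun k => by
    simp [M, a]
    ring
  have hzero : ∀ i k, k + 1 < i → M i k = 0 := fun i k h => by
    simp [M, a, show i ≠ k by omega, show ¬ i ≤ k by omega, show i ≠ k + 1 by omega]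
  have key : ∀ k ≤ n, leadingMinor M k = F k := by
    intro k
    induction k using Nat.strong_induction_on with
    | _ k ih =>
      intro hk
      rcases k with _ | k
      · simp [leadingMinor, hF0]
      · rw [det_hessenberg_succ M X hsub hzero, hrec k hk]
        have e : ∀ l ∈ Finset.range (k + 1), M (k - l) k * X ^ l * leadingMinor M (k - l) =
            (if l = 0 then C (X - C (r k)) * F k else 0) +
              C (C (b k l)) * X ^ (l + 1) * F (k - l) := by
          intro l hl
          rw [Finset.mem_range] at hl
          rw [ih (k - l) (by omega) (by omega)]
          rcases l with _ | l
          · simp [M, a]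
            ring
          · simp [M, a, show k - (l + 1) ≠ k by omega, show k - (k - (l + 1)) = l + 1 by omega]
            left
            ring
        rw [Finset.sum_congr rfl e, Finset.sum_add_distrib]
        simp
  refine ⟨Matrix.of fun i j => a i j, ?_⟩
  rw [← hFn, ← key n le_rfl, leadingMinor]
  congr 1
  ext1 i j
  simp [M, Fin.ext_iff]

end

section
variable {K : Type*} [Field K]

/-- A member of `K[x][y]` with total degree at most `n`. -/
def TotalDegreeLE (n : ℕ) (q : K[X][X]) : Prop :=
  ∀ m, (q.coeff m).degree < (n + 1 - m : ℕ)

theorem TotalDegreeLE.mul {a b : ℕ} {p q : K[X][X]} (hp : TotalDegreeLE a p)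
    (hq : TotalDegreeLE b q) : TotalDegreeLE (a + b) (p * q) := by
  intro m
  rw [coeff_mul]
  refine (degree_sum_le _ _).trans_lt ((Finset.sup_lt_iff (WithBot.bot_lt_coe _)).2 ?_)
  rintro ⟨i, j⟩ hij
  rw [Finset.HasAntidiagonal.mem_antidiagonal] at hij
  dsimp only at hij ⊢
  have h1 := hp i
  have h2 := hq j
  rcases eq_or_ne (p.coeff i) 0 with h | h
  · simp [h]
  rcases eq_or_ne (q.coeff j) 0 with h' | h'
  · simp [h']
  rw [degree_eq_natDegree h] at h1
  rw [degree_eq_natDegree h'] at h2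
  rw [degree_mul, degree_eq_natDegree h, degree_eq_natDegree h']
  norm_cast at h1 h2 ⊢
  omega

theorem TotalDegreeLE.mono {a b : ℕ} (hab : a ≤ b) {p : K[X][X]} (hp : TotalDegreeLE a p) :
    TotalDegreeLE b p := fun m =>
  (hp m).trans_le (by norm_cast; omega)

theorem totalDegreeLE_C_C (c : K) : TotalDegreeLE 0 (C (C c) : K[X][X]) := by
  intro m
  rcases m with _ | m
  · simpa using degree_C_le.trans_lt (by norm_num : (0 : WithBot ℕ) < 1)
  · simp

theorem TotalDegreeLE.pow {a : ℕ} {p : K[X][X]} (hp : TotalDegreeLE a p) (k : ℕ) :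
    TotalDegreeLE (k * a) (p ^ k) := by
  induction k with
  | zero => simpa using totalDegreeLE_C_C (1 : K)
  | succ k ih =>
    rw [pow_succ, Nat.succ_mul]
    exact ih.mul hp

theorem totalDegreeLE_one_C_add {l : K[X]} (hl : l.natDegree ≤ 1) (c : K) :
    TotalDegreeLE 1 (C l + C (C c) * X) := by
  intro m
  rcases m with _ | _ | m
  · simpa using (degree_le_of_natDegree_le hl).trans_lt (by norm_num)
  · simpa [coeff_C] using degree_C_le.trans_lt (by norm_num : (0 : WithBot ℕ) < 1)
  · simp

theorem add_le_totalDegree {p : MvPolynomial (Fin 2) K} {d : Fin 2 →₀ ℕ} (hd : d ∈ p.support) :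
    d 0 + d 1 ≤ p.totalDegree := by
  simpa [Finsupp.sum_fintype] using MvPolynomial.le_totalDegree hd

/-- Substituting `x` and `l(x) + y` with `l` affine does not increase the total degree. -/
theorem totalDegreeLE_aeval {l : K[X]} (hl : l.natDegree ≤ 1) (p : MvPolynomial (Fin 2) K) :
    TotalDegreeLE p.totalDegree (MvPolynomial.aeval ![C X, C l + X] p : K[X][X]) := by
  intro m
  rw [MvPolynomial.aeval_def, MvPolynomial.eval₂_eq', finsetSum_coeff]
  refine (degree_sum_le _ _).trans_lt ((Finset.sup_lt_iff (WithBot.bot_lt_coe _)).2 ?_)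
  intro d hd
  have h1 : TotalDegreeLE 1 (C X : K[X][X]) := by
    simpa using totalDegreeLE_one_C_add (natDegree_X_le (R := K)) 0
  have h2 : TotalDegreeLE 1 (C l + X : K[X][X]) := by
    simpa using totalDegreeLE_one_C_add hl 1
  have h := (totalDegreeLE_C_C (MvPolynomial.coeff d p)).mul ((h1.pow (d 0)).mul (h2.pow (d 1)))
  have hle := add_le_totalDegree hd
  rw [Fin.prod_univ_two]
  exact h.mono (by omega) m

/-- The coefficient of the highest possible power after restricting to a line. -/
theorem coeff_totalDegree_aeval_line (p : MvPolynomial (Fin 2) K) (t s : K) :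
    (MvPolynomial.aeval ![X, C t * X + C s] p : K[X]).coeff p.totalDegree =
      ∑ d ∈ p.support with d 0 + d 1 = p.totalDegree, MvPolynomial.coeff d p * t ^ d 1 := by
  rw [MvPolynomial.aeval_def, MvPolynomial.eval₂_eq', finsetSum_coeff, Finset.sum_filter]
  refine Finset.sum_congr rfl fun d hd => ?_
  have hle := add_le_totalDegree hd
  have hlin : (C t * X + C s : K[X]).natDegree ≤ 1 := natDegree_linear_le
  rw [Fin.prod_univ_two, ← C_eq_algebraMap, coeff_C_mul]
  simp only [Matrix.cons_val_zero, Matrix.cons_val_one]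
  rw [coeff_X_pow_mul', if_pos (by omega)]
  split_ifs with h
  · have := coeff_pow_of_natDegree_le (m := d 1) hlin
    rw [show p.totalDegree - d 0 = d 1 * 1 by omega, this]
    simp
  · rw [coeff_eq_zero_of_natDegree_lt, mul_zero]
    exact (natDegree_pow_le_of_le (d 1) hlin).trans_lt (by omega)

/-- Lines of almost every slope meet the curve in the full number of points. -/
theorem exists_slope [Infinite K] {p : MvPolynomial (Fin 2) K} (hp : p ≠ 0) :
    ∃ t : K, ∀ s : K,
      (MvPolynomial.aeval ![X, C t * X + C s] p : K[X]).coeff p.totalDegree ≠ 0 := by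
  simp_rw [coeff_totalDegree_aeval_line]
  set S := p.support.filter fun d => d 0 + d 1 = p.totalDegree with hS
  let g : K[X] := ∑ d ∈ S, monomial (d 1) (MvPolynomial.coeff d p)
  have hg : g ≠ 0 := by
    obtain ⟨d, hd, hdeg⟩ := Finset.exists_mem_eq_sup p.support
      (MvPolynomial.support_nonempty.2 hp) fun s => s.sum fun _ e => e
    have hd' : d ∈ S := by
      rw [hS, Finset.mem_filter]
      refine ⟨hd, ?_⟩
      rw [MvPolynomial.totalDegree, hdeg]
      simp [Finsupp.sum_fintype]
    have hc : g.coeff (d 1) = MvPolynomial.coeff d p := by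
      simp only [g, finsetSum_coeff, coeff_monomial]
      rw [Finset.sum_eq_single_of_mem d hd']
      · simp
      · intro e he hne
        rw [if_neg]
        intro h1
        apply hne
        rw [hS, Finset.mem_filter] at he hd'
        ext i
        fin_cases i
        · have := he.2.trans hd'.2.symm
          simp only [Fin.zero_eta]
          omega
        · exact h1
    intro h0
    rw [h0, coeff_zero] at hc
    exact MvPolynomial.mem_support_iff.1 hd hc.symm
  obtain ⟨t, ht⟩ : ∃ t, g.eval t ≠ 0 := by
    by_contra! h
    exact hg (Polynomial.funext fun t => by simp [h t])
  refine ⟨t, fun _ => ?_⟩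
  simpa [g, eval_finsetSum] using ht

/-- An irreducible family of polynomials has a separable member. -/
theorem exists_separable_map_eval [CharZero K] {F : K[X][X]} (hF : Irreducible F)
    (hdeg : F.natDegree ≠ 0) : ∃ s : K, (F.map (evalRingHom s)).Separable := by
  have hirr := (hF.isPrimitive hdeg).irreducible_iff_irreducible_map_fraction_map
    (K := FractionRing K[X]) |>.1 hF
  have : CharZero (FractionRing K[X]) :=
    charZero_of_injective_algebraMap (FaithfulSMul.algebraMap_injective K[X] (FractionRing K[X]))
  obtain ⟨a, b, hab⟩ := hirr.separable
  obtain ⟨u, hu, ha⟩ := IsLocalization.integerNormalization_spec (nonZeroDivisors K[X]) a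
  obtain ⟨v, hv, hb⟩ := IsLocalization.integerNormalization_spec (nonZeroDivisors K[X]) b
  set a' := IsLocalization.integerNormalization (nonZeroDivisors K[X]) a
  set b' := IsLocalization.integerNormalization (nonZeroDivisors K[X]) b
  have key : C v * a' * F + C u * b' * derivative F = C (u * v) := by
    apply map_injective _ (FaithfulSMul.algebraMap_injective K[X] (FractionRing K[X]))
    simp only [Polynomial.map_add, Polynomial.map_mul, map_C, ha, hb, ← derivative_map, map_mul,
      Algebra.smul_def, Polynomial.algebraMap_apply]
    linear_combination C (algebraMap K[X] (FractionRing K[X]) u) *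
      C (algebraMap K[X] (FractionRing K[X]) v) * hab
  have huv : u * v ≠ 0 := mul_ne_zero (nonZeroDivisors.ne_zero hu) (nonZeroDivisors.ne_zero hv)
  obtain ⟨s, hs⟩ : ∃ s, (u * v).eval s ≠ 0 := by
    by_contra! h
    exact huv (Polynomial.funext fun t => by simp [h t])
  refine ⟨s, ?_⟩
  have h := congrArg (Polynomial.map (evalRingHom s)) key
  simp only [Polynomial.map_add, Polynomial.map_mul, map_C, ← derivative_map,
    coe_evalRingHom] at h
  refine ⟨C ((u * v).eval s)⁻¹ * (C (v.eval s) * a'.map (evalRingHom s)),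
    C ((u * v).eval s)⁻¹ * (C (u.eval s) * b'.map (evalRingHom s)), ?_⟩
  have hinv : (C ((u * v).eval s)⁻¹ : K[X]) * C ((u * v).eval s) = 1 := by
    rw [← C_mul, inv_mul_cancel₀ hs, C_1]
  linear_combination C ((u * v).eval s)⁻¹ * h + hinv

/-- The change of variables `y = t x + s`, viewing `s` as the new coefficient variable. -/
noncomputable def shearEquiv (t : K) : MvPolynomial (Fin 2) K ≃+* K[X][X] :=
  RingEquiv.ofRingHom
    (MvPolynomial.aeval ![X, C (C t) * X + C X] : MvPolynomial (Fin 2) K →ₐ[K] K[X][X]).toRingHom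
    (eval₂RingHom
      (aeval (MvPolynomial.X 1 - MvPolynomial.C t * MvPolynomial.X 0 :
        MvPolynomial (Fin 2) K)).toRingHom
      (MvPolynomial.X 0))
    (by
      refine ringHom_ext' (ringHom_ext' ?_ ?_) ?_
      · ext c
        simp
      · simp
      · simp)
    (by
      refine MvPolynomial.ringHom_ext (fun c => ?_) fun i => ?_
      · simp
      · fin_cases i <;> simp)

theorem map_eval_shearEquiv (t s : K) (p : MvPolynomial (Fin 2) K) :
    (shearEquiv t p).map (evalRingHom s) = MvPolynomial.aeval ![X, C t * X + C s] p := by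
  have : (mapRingHom (evalRingHom s)).comp (shearEquiv t : MvPolynomial (Fin 2) K →+* K[X][X]) =
      (MvPolynomial.aeval ![X, C t * X + C s] : MvPolynomial (Fin 2) K →ₐ[K] K[X]).toRingHom := by
    refine MvPolynomial.ringHom_ext (fun c => ?_) fun i => ?_
    · simp [shearEquiv]
    · fin_cases i <;> simp [shearEquiv]
  exact RingHom.congr_fun this p

/-- A polynomial over an algebraically closed field with simple roots is, up to a constant, a
product over an injective enumeration of its roots. -/
theorem exists_enum_roots [IsAlgClosed K] {f : K[X]} (hf : f.Separable) :
    ∃ r : ℕ → K, Set.InjOn r (Set.Iio f.natDegree) ∧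
      f = C f.leadingCoeff * ∏ i ∈ Finset.range f.natDegree, (X - C (r i)) := by
  classical
  have hcard : f.roots.card = f.natDegree := IsAlgClosed.card_roots_eq_natDegree
  have hnd := nodup_roots hf
  let e := Finset.equivFinOfCardEq (s := f.roots.toFinset)
    ((Multiset.toFinset_card_of_nodup hnd).trans hcard)
  refine ⟨fun i => if h : i < f.natDegree then e.symm ⟨i, h⟩ else 0, ?_, ?_⟩
  · intro i hi j hj hij
    rw [Set.mem_Iio] at hi hj
    simpa [hi, hj, Subtype.coe_inj] using hij
  · conv_lhs => rw [← C_leadingCoeff_mul_prod_multiset_X_sub_C hcard]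
    congr 1
    rw [Finset.prod_range]
    simp only [Fin.is_lt, dif_pos, Fin.eta]
    rw [Equiv.prod_comp e.symm fun x => X - C (x : K),
      Finset.prod_coe_sort f.roots.toFinset fun x => X - C x, Finset.prod,
      Multiset.toFinset_val, hnd.dedup]

/-- `p` is, up to a constant, the determinant of a matrix of affine forms of order its degree. -/
def HasScaledDetRep (n : ℕ) (p : MvPolynomial (Fin 2) K) : Prop :=
  ∃ (c : K) (A B D : Matrix (Fin n) (Fin n) K),
    p = MvPolynomial.C c * (Matrix.of fun i j =>
      MvPolynomial.C (A i j) + MvPolynomial.X 0 * MvPolynomial.C (B i j)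
        + MvPolynomial.X 1 * MvPolynomial.C (D i j)).det

theorem HasScaledDetRep.mul {m n : ℕ} {p q : MvPolynomial (Fin 2) K} (hp : HasScaledDetRep m p)
    (hq : HasScaledDetRep n q) : HasScaledDetRep (m + n) (p * q) := by
  obtain ⟨c, A, B, D, hp⟩ := hp
  obtain ⟨c', A', B', D', hq⟩ := hq
  let e : Fin m ⊕ Fin n ≃ Fin (m + n) := finSumFinEquiv
  refine ⟨c * c', (Matrix.fromBlocks A 0 0 A').submatrix e.symm e.symm,
    (Matrix.fromBlocks B 0 0 B').submatrix e.symm e.symm,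
    (Matrix.fromBlocks D 0 0 D').submatrix e.symm e.symm, ?_⟩
  rw [hp, hq, MvPolynomial.C_mul, mul_mul_mul_comm, ← Matrix.det_fromBlocks_zero₂₁ _ 0,
    ← Matrix.det_submatrix_equiv_self e.symm]
  congr 2
  ext1 i j
  simp only [Matrix.submatrix_apply, Matrix.of_apply]
  rcases e.symm i with i | i <;> rcases e.symm j with j | j <;> simp

theorem hasScaledDetRep_of_irreducible [IsAlgClosed K] [CharZero K] {p : MvPolynomial (Fin 2) K}
    (hp : Irreducible p) : HasScaledDetRep p.totalDegree p := by
  obtain ⟨t, ht⟩ := exists_slope hp.ne_zero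
  set n := p.totalDegree with hn
  have hn0 : n ≠ 0 := by
    intro h0
    have hC := MvPolynomial.totalDegree_eq_zero_iff_eq_C.1 (hn ▸ h0)
    refine hp.not_isUnit ?_
    rw [hC]
    exact (Ne.isUnit fun h => hp.ne_zero (by rw [hC, h, MvPolynomial.C_0])).map MvPolynomial.C
  have hFdeg : (shearEquiv t p).natDegree ≠ 0 := by
    intro h0
    have h := ht 0
    rw [← map_eval_shearEquiv, coeff_map, coeff_eq_zero_of_natDegree_lt (by omega)] at h
    simp at h
  obtain ⟨s, hs⟩ := exists_separable_map_eval
    ((MulEquiv.irreducible_iff (shearEquiv t)).2 hp) hFdeg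
  rw [map_eval_shearEquiv] at hs
  set f : K[X] := MvPolynomial.aeval ![X, C t * X + C s] p
  let q : K[X][X] := MvPolynomial.aeval ![C X, C (C t * X + C s) + X] p
  have hq : TotalDegreeLE n q := totalDegreeLE_aeval natDegree_linear_le p
  have hq0 : q.coeff 0 = f := by
    have : (constantCoeff : K[X][X] →+* K[X]).comp
        (MvPolynomial.aeval ![C X, C (C t * X + C s) + X] :
          MvPolynomial (Fin 2) K →ₐ[K] K[X][X]).toRingHom =
        (MvPolynomial.aeval ![X, C t * X + C s] :
          MvPolynomial (Fin 2) K →ₐ[K] K[X]).toRingHom := by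
      refine MvPolynomial.ringHom_ext (fun c => ?_) fun i => ?_
      · simp
      · fin_cases i <;> simp
    exact RingHom.congr_fun this p
  have hfn : f.natDegree = n := by
    refine le_antisymm ?_ (le_natDegree_of_ne_zero (ht s))
    have := hq 0
    rw [hq0] at this
    exact Nat.lt_succ_iff.1 ((natDegree_lt_iff_degree_lt hs.ne_zero).2 this)
  obtain ⟨r, hr, hprod⟩ := exists_enum_roots hs
  rw [hfn] at hr hprod
  have hlc : f.leadingCoeff ≠ 0 := leadingCoeff_ne_zero.2 hs.ne_zero
  obtain ⟨A, hA⟩ := exists_det_eq_of_coeff_zero_eq_prod r n hr (C (C f.leadingCoeff⁻¹) * q)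
    (by
      rw [coeff_C_mul, hq0]
      refine mul_left_cancel₀ (C_ne_zero.2 hlc) ?_
      rw [← hprod, ← mul_assoc, ← C_mul, mul_inv_cancel₀ hlc, C_1, one_mul])
    (fun m => by
      have h := (totalDegreeLE_C_C f.leadingCoeff⁻¹).mul hq m
      rwa [zero_add] at h)
  let θ : K[X][X] →+* MvPolynomial (Fin 2) K :=
    eval₂RingHom (aeval (MvPolynomial.X 0 : MvPolynomial (Fin 2) K)).toRingHom
      (MvPolynomial.X 1 - MvPolynomial.C t * MvPolynomial.X 0 - MvPolynomial.C s)
  have hθq : θ q = p := by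
    have : θ.comp (MvPolynomial.aeval ![C X, C (C t * X + C s) + X] :
          MvPolynomial (Fin 2) K →ₐ[K] K[X][X]).toRingHom = RingHom.id _ := by
      refine MvPolynomial.ringHom_ext (fun c => ?_) fun i => ?_
      · simp [θ]
      · fin_cases i <;> simp [θ]
    exact RingHom.congr_fun this p
  refine ⟨f.leadingCoeff, Matrix.diagonal (fun i : Fin n => -r i) - s • A, 1 - t • A, A, ?_⟩
  have hdet : θ (Matrix.det _) = _ := congrArg θ hA
  rw [map_mul, hθq, RingHom.map_det] at hdet
  have hθC : θ (C (C f.leadingCoeff⁻¹)) = MvPolynomial.C f.leadingCoeff⁻¹ := by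
    simp [θ]
  have hmat : (Matrix.of fun i j =>
      MvPolynomial.C ((Matrix.diagonal (fun i : Fin n => -r i) - s • A) i j)
        + MvPolynomial.X 0 * MvPolynomial.C ((1 - t • A : Matrix (Fin n) (Fin n) K) i j)
        + MvPolynomial.X 1 * MvPolynomial.C (A i j)) =
      θ.mapMatrix (Matrix.of fun i j : Fin n =>
        (if i = j then C (X - C (r i)) else 0) + X * C (C (A i j))) := by
    ext1 i j
    rcases eq_or_ne i j with rfl | h
    · simp [θ]
      ring
    · simp [θ, h]
      ring
  rw [hmat, hdet, hθC, ← mul_assoc, ← MvPolynomial.C_mul, mul_inv_cancel₀ hlc, MvPolynomial.C_1,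
    one_mul]

theorem hasScaledDetRep_of_ne_zero [IsAlgClosed K] [CharZero K] (p : MvPolynomial (Fin 2) K)
    (hp : p ≠ 0) : HasScaledDetRep p.totalDegree p := by
  induction p using WfDvdMonoid.induction_on_irreducible with
  | zero => exact absurd rfl hp
  | unit u hu =>
    obtain ⟨c, -, rfl⟩ := MvPolynomial.isUnit_iff_eq_C_of_isReduced.1 hu
    rw [MvPolynomial.totalDegree_C]
    exact ⟨c, 0, 0, 0, by simp⟩
  | mul a i ha hi ih =>
    rw [MvPolynomial.totalDegree_mul_of_isDomain hi.ne_zero ha]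
    exact (hasScaledDetRep_of_irreducible hi).mul (ih ha)

end

/-- Every bivariate polynomial `p` over `ℂ` of total degree `n ≥ 1`
admits a determinantal representation of order `n`:
there are matrices `A, B, C ∈ ℂ^{n×n}` with `det(A + x B + y C) = p(x, y)`. -/
theorem bivariate_det_representation
    (n : ℕ) (hn : 1 ≤ n) (p : MvPolynomial (Fin 2) ℂ)
    (hdeg : p.totalDegree = n) :
    ∃ A B C : Matrix (Fin n) (Fin n) ℂ,
      (Matrix.of fun i j =>
          MvPolynomial.C (A i j)
          + MvPolynomial.X 0 * MvPolynomial.C (B i j)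
          + MvPolynomial.X 1 * MvPolynomial.C (C i j)).det = p := by
  obtain ⟨m, rfl⟩ : ∃ m, n = m + 1 := ⟨n - 1, by omega⟩
  have hp : p ≠ 0 := by
    rintro rfl
    simp at hdeg
  obtain ⟨c, A, B, D, h⟩ := hdeg ▸ hasScaledDetRep_of_ne_zero p hp
  refine ⟨A.updateRow 0 (c • A 0), B.updateRow 0 (c • B 0), D.updateRow 0 (c • D 0), ?_⟩
  rw [h, ← Matrix.updateRow_eq_self (Matrix.of fun i j => MvPolynomial.C (A i j) + _ + _) 0,
    ← Matrix.det_updateRow_smul]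
  congr 1
  ext1 i j
  rcases eq_or_ne i 0 with rfl | hi
  · simp
    ring
  · simp [hi]
end

section
/- Let p be a bivariate polynomial over ℂ of degree n with p_{n0} ≠ 0, let p_h be its homogenization, and suppose the univariate polynomial h(ξ) := p_h(ξ,1,0) = p_{n0}ξ^n + p_{n-1,1}ξ^{n-1} + ⋯ + p_{0n} has n simple roots. Then there exist s, t ∈ ℂ such that the polynomial p̃(x̃,ỹ) obtained from p by the substitution x = x̃ + sỹ + t, y = ỹ satisfies: (i) p̃_{n0} = p_{n0} ≠ 0; (ii) p̃_{0n} = p̃_{0,n-1} = 0; and (iii) the polynomial h̃(ξ) := p̃_h(ξ,1,0) has n simple roots. In fact one may take s to be any root of h and t = −(p_{n-1,0}s^{n-1} + p_{n-2,1}s^{n-2} + ⋯ + p_{1,n-2}s + p_{0,n-1})/h'(s), which is well defined since h'(s) ≠ 0. -/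
/-- The dehomogenization `q_d(ξ, 1)` of the degree-`d` homogeneous component of `q`. -/
noncomputable def degreeSlice {R : Type*} [CommSemiring R] (d : ℕ) (q : MvPolynomial (Fin 2) R) :
    Polynomial R :=
  ∑ i ∈ Finset.range (d + 1),
    Polynomial.C (MvPolynomial.coeff (Finsupp.single 0 i + Finsupp.single 1 (d - i)) q) *
      Polynomial.X ^ i

section degreeSlice

open Polynomial

variable {R : Type*} [CommSemiring R]

lemma degreeSlice_add (d : ℕ) (q r : MvPolynomial (Fin 2) R) :
    degreeSlice d (q + r) = degreeSlice d q + degreeSlice d r := by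
  simp [degreeSlice, add_mul, Finset.sum_add_distrib]

lemma degreeSlice_sum {ι : Type*} (d : ℕ) (s : Finset ι) (f : ι → MvPolynomial (Fin 2) R) :
    degreeSlice d (∑ i ∈ s, f i) = ∑ i ∈ s, degreeSlice d (f i) := by
  classical
  induction s using Finset.induction_on with
  | empty => simp [degreeSlice]
  | insert a s ha ih => rw [Finset.sum_insert ha, Finset.sum_insert ha, degreeSlice_add, ih]

lemma coeff_degreeSlice (d : ℕ) (q : MvPolynomial (Fin 2) R) {i : ℕ} (hi : i ≤ d) :
    (degreeSlice d q).coeff i =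
      MvPolynomial.coeff (Finsupp.single 0 i + Finsupp.single 1 (d - i)) q := by
  simp only [degreeSlice, finsetSum_coeff, coeff_C_mul_X_pow]
  rw [Finset.sum_ite_eq, if_pos (by simp; omega)]

lemma natDegree_degreeSlice_le (d : ℕ) (q : MvPolynomial (Fin 2) R) :
    (degreeSlice d q).natDegree ≤ d :=
  natDegree_sum_le_of_forall_le _ _ fun _ hi =>
    (natDegree_C_mul_X_pow_le _ _).trans (Nat.lt_succ_iff.mp (Finset.mem_range.mp hi))

lemma degreeSlice_monomial (d : ℕ) (m : Fin 2 →₀ ℕ) (c : R) :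
    degreeSlice d (MvPolynomial.monomial m c) =
      if m 0 + m 1 = d then C c * X ^ m 0 else 0 := by
  have key (i : ℕ) (hi : i ∈ Finset.range (d + 1)) :
      m = Finsupp.single 0 i + Finsupp.single 1 (d - i) ↔ m 0 + m 1 = d ∧ m 0 = i := by
    rw [Finset.mem_range] at hi
    simp only [Finsupp.ext_iff, Fin.forall_fin_two, Finsupp.add_apply, Finsupp.single_apply]
    simp
    omega
  rw [degreeSlice, Finset.sum_congr rfl fun i hi => by
    rw [MvPolynomial.coeff_monomial, if_congr (key i hi) rfl rfl]]
  split_ifs with h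
  · rw [Finset.sum_eq_single (m 0)]
    · simp [h]
    · intro b _ hb
      simp [hb.symm]
    · simp only [Finset.mem_range]
      omega
  · simp [h]

/-- `degreeSlice d q` is the coefficient of `T ^ d` in `q(ξT, T)`. -/
lemma degreeSlice_eq_coeff_aeval (d : ℕ) (q : MvPolynomial (Fin 2) R) :
    degreeSlice d q = (MvPolynomial.aeval ![C X * X, (X : R[X][X])] q).coeff d := by
  induction q using MvPolynomial.induction_on' with
  | monomial m c =>
    have : algebraMap R R[X][X] c = C (C c) := rfl
    rw [degreeSlice_monomial, MvPolynomial.aeval_monomial, Finsupp.prod_fintype _ _ (by simp)]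
    simp only [Fin.prod_univ_two, Matrix.cons_val_zero, Matrix.cons_val_one, mul_pow, this,
      mul_assoc, ← pow_add, ← C_pow, coeff_C_mul, coeff_X_pow]
    split_ifs with h1 h2 h2 <;> first | omega | simp
  | add q r hq hr => rw [degreeSlice_add, map_add, coeff_add, hq, hr]

lemma coeff_linear_pow_of_lt (a b : R) {i j : ℕ} (h : i < j) :
    ((C a * X + C b) ^ i).coeff j = 0 :=
  coeff_eq_zero_of_natDegree_lt <|
    (natDegree_pow_le_of_le i natDegree_linear_le).trans_lt (by simpa using h)

lemma coeff_linear_pow_self (a b : R) (i : ℕ) : ((C a * X + C b) ^ i).coeff i = a ^ i := by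
  induction i with
  | zero => simp
  | succ i ih =>
    rw [pow_succ', add_mul, mul_assoc, coeff_add, coeff_C_mul, coeff_X_mul, ih, coeff_C_mul,
      coeff_linear_pow_of_lt a b i.lt_succ_self, mul_zero, add_zero, pow_succ']

lemma coeff_linear_pow_succ (a b : R) (i : ℕ) :
    ((C a * X + C b) ^ (i + 1)).coeff i = b * ((i + 1) * a ^ i) := by
  induction i with
  | zero => simp
  | succ i ih =>
    rw [pow_succ', add_mul, mul_assoc, coeff_add, coeff_C_mul, coeff_X_mul, ih, coeff_C_mul,
      coeff_linear_pow_self]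
    push_cast
    ring

/-- The substitution `x ↦ x + s y + t`, `y ↦ y`. -/
noncomputable def shear (s t : R) : MvPolynomial (Fin 2) R →ₐ[R] MvPolynomial (Fin 2) R :=
  MvPolynomial.aeval
    ![MvPolynomial.X 0 + MvPolynomial.C s * MvPolynomial.X 1 + MvPolynomial.C t,
      MvPolynomial.X 1]

lemma degreeSlice_shear_monomial (d : ℕ) (s t : R) (m : Fin 2 →₀ ℕ) (c : R) :
    degreeSlice d (shear s t (MvPolynomial.monomial m c)) =
      C c * ((C (X + C s) * X + C (C t)) ^ m 0 * X ^ m 1 : R[X][X]).coeff d := by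
  have hC (c : R) : algebraMap R R[X][X] c = C (C c) := rfl
  rw [degreeSlice_eq_coeff_aeval, shear, MvPolynomial.aeval_monomial,
    Finsupp.prod_fintype _ _ (by simp), Fin.prod_univ_two]
  simp only [MvPolynomial.algebraMap_eq, map_mul, map_pow, map_add, MvPolynomial.aeval_X,
    MvPolynomial.aeval_C, Matrix.cons_val_zero, Matrix.cons_val_one, hC, coeff_C_mul, add_mul]

lemma degreeSlice_shear_top (k : ℕ) (s t : R) (p : MvPolynomial (Fin 2) R)
    (hp : p.totalDegree ≤ k) :
    degreeSlice k (shear s t p) = (degreeSlice k p).comp (X + C s) := by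
  rw [← MvPolynomial.support_sum_monomial_coeff p]
  simp only [map_sum, degreeSlice_sum, sum_comp]
  refine Finset.sum_congr rfl fun m hm => ?_
  have hmk : m 0 + m 1 ≤ k := by
    have := (MvPolynomial.le_totalDegree hm).trans hp
    rwa [Finsupp.sum_fintype _ _ (by simp), Fin.sum_univ_two] at this
  rw [degreeSlice_shear_monomial, degreeSlice_monomial]
  split_ifs with h
  · rw [← h, coeff_mul_X_pow, coeff_linear_pow_self]
    simp
  · obtain ⟨j, rfl⟩ := Nat.exists_eq_add_of_le (show m 1 ≤ k by omega)
    rw [add_comm (m 1), coeff_mul_X_pow, coeff_linear_pow_of_lt _ _ (by omega)]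
    simp

lemma degreeSlice_shear_subtop (k : ℕ) (s t : R) (p : MvPolynomial (Fin 2) R)
    (hp : p.totalDegree ≤ k + 1) :
    degreeSlice k (shear s t p) =
      (degreeSlice k p + C t * derivative (degreeSlice (k + 1) p)).comp (X + C s) := by
  rw [← MvPolynomial.support_sum_monomial_coeff p]
  simp only [map_sum, degreeSlice_sum, sum_comp, Finset.mul_sum,
    ← Finset.sum_add_distrib]
  refine Finset.sum_congr rfl fun m hm => ?_
  have hmk : m 0 + m 1 ≤ k + 1 := by
    have := (MvPolynomial.le_totalDegree hm).trans hp
    rwa [Finsupp.sum_fintype _ _ (by simp), Fin.sum_univ_two] at this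
  rw [degreeSlice_shear_monomial, degreeSlice_monomial, degreeSlice_monomial]
  generalize m 0 = a at *
  generalize m 1 = b at *
  rcases hmk.lt_or_eq with hlt | heq
  · obtain ⟨j, rfl⟩ := Nat.exists_eq_add_of_le' (show b ≤ k by omega)
    rw [coeff_mul_X_pow, if_neg hlt.ne]
    rcases (show a ≤ j by omega).lt_or_eq with h | rfl
    · rw [coeff_linear_pow_of_lt _ _ h, if_neg (by omega)]
      simp
    · rw [coeff_linear_pow_self]
      simp
  · rw [if_neg (by omega), if_pos heq]
    cases a with
    | zero =>
      obtain rfl : b = k + 1 := by omega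
      simp [coeff_X_pow]
    | succ a =>
      obtain rfl : a + b = k := by omega
      rw [coeff_mul_X_pow, coeff_linear_pow_succ]
      simp
      ring

end degreeSlice

/-- Let `p` be a bivariate polynomial of degree `n` with
`p_{n0} ≠ 0` such that `h(ξ) = p_h(ξ,1,0) = ∑_{i=0}^n p_{i,n-i} ξ^i` has `n`
simple roots. Then `h` has a root, and for every root `s` of `h` and
`t = -(∑_{i=0}^{n-1} p_{i,n-1-i} s^i)/h'(s)`, the polynomial `p̃` obtained by the
substitution `x = x̃ + sỹ + t`, `y = ỹ` satisfies (i) `p̃_{n0} = p_{n0}`,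
(ii) `p̃_{0n} = p̃_{0,n-1} = 0`, and (iii) all roots of
`h̃(ξ) = ∑_{i=0}^n p̃_{i,n-i} ξ^i` are simple. -/
theorem preliminary_substitution_kills_top_y_coefficients
    (n : ℕ) (hn : 1 ≤ n) (p : MvPolynomial (Fin 2) ℂ)
    (hdeg : p.totalDegree = n)
    (hpn0 : MvPolynomial.coeff (Finsupp.single 0 n + Finsupp.single 1 0) p ≠ 0)
    (h : Polynomial ℂ)
    (hh : h = ∑ i ∈ Finset.range (n + 1),
      Polynomial.C (MvPolynomial.coeff (Finsupp.single 0 i + Finsupp.single 1 (n - i)) p) *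
        Polynomial.X ^ i)
    (hsimple : ∀ z : ℂ, h.eval z = 0 → h.derivative.eval z ≠ 0) :
    (∃ s : ℂ, h.eval s = 0) ∧
    ∀ s : ℂ, h.eval s = 0 →
    ∀ t : ℂ, t = -(∑ i ∈ Finset.range n,
        MvPolynomial.coeff (Finsupp.single 0 i + Finsupp.single 1 (n - 1 - i)) p * s ^ i) /
        h.derivative.eval s →
    ∀ pt : MvPolynomial (Fin 2) ℂ,
      pt = MvPolynomial.aeval
        ![MvPolynomial.X 0 + MvPolynomial.C s * MvPolynomial.X 1 + MvPolynomial.C t,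
          MvPolynomial.X 1] p →
    ∀ ht : Polynomial ℂ,
      ht = ∑ i ∈ Finset.range (n + 1),
        Polynomial.C (MvPolynomial.coeff (Finsupp.single 0 i + Finsupp.single 1 (n - i)) pt) *
          Polynomial.X ^ i →
      (MvPolynomial.coeff (Finsupp.single 0 n + Finsupp.single 1 0) pt =
        MvPolynomial.coeff (Finsupp.single 0 n + Finsupp.single 1 0) p) ∧
      MvPolynomial.coeff (Finsupp.single 0 0 + Finsupp.single 1 n) pt = 0 ∧
      MvPolynomial.coeff (Finsupp.single 0 0 + Finsupp.single 1 (n - 1)) pt = 0 ∧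
      (∀ z : ℂ, ht.eval z = 0 → ht.derivative.eval z ≠ 0) := by
  obtain ⟨k, rfl⟩ : ∃ k, n = k + 1 := ⟨n - 1, by omega⟩
  change h = degreeSlice (k + 1) p at hh
  have hcoeff : h.coeff (k + 1) ≠ 0 := by
    simpa [hh, coeff_degreeSlice] using hpn0
  have hnat : h.natDegree = k + 1 :=
    le_antisymm (hh ▸ natDegree_degreeSlice_le _ _) (Polynomial.le_natDegree_of_ne_zero hcoeff)
  refine ⟨Complex.exists_root (Polynomial.natDegree_pos_iff_degree_pos.mp (by omega)), ?_⟩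
  intro s hs t ht pt hpt q hq
  change pt = shear s t p at hpt
  change q = degreeSlice (k + 1) pt at hq
  have hqc : q = h.comp (Polynomial.X + Polynomial.C s) := by
    rw [hq, hpt, degreeSlice_shear_top _ _ _ _ hdeg.le, hh]
  refine ⟨?_, ?_, ?_, fun z hz => ?_⟩
  · have htop : q.coeff (k + 1) = h.coeff (k + 1) := by
      rw [hqc, ← Polynomial.taylor_apply, ← hnat, Polynomial.coeff_taylor_natDegree,
        Polynomial.leadingCoeff]
    rwa [hq, hh, coeff_degreeSlice _ _ le_rfl, coeff_degreeSlice _ _ le_rfl, Nat.sub_self] at htop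
  · have hbot : q.coeff 0 = 0 := by
      rw [hqc, Polynomial.coeff_zero_eq_eval_zero]
      simpa using hs
    rwa [hq, coeff_degreeSlice _ _ (Nat.zero_le _)] at hbot
  · have hslice : (degreeSlice k p).eval s = ∑ i ∈ Finset.range (k + 1),
        MvPolynomial.coeff (Finsupp.single 0 i + Finsupp.single 1 (k - i)) p * s ^ i := by
      simp [degreeSlice, Polynomial.eval_finsetSum]
    have hbot : (degreeSlice k pt).coeff 0 = 0 := by
      rw [hpt, degreeSlice_shear_subtop _ _ _ _ hdeg.le, ← hh,
        Polynomial.coeff_zero_eq_eval_zero]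
      simp only [Nat.add_sub_cancel, ← hslice] at ht
      simp [ht, div_mul_cancel₀ _ (hsimple s hs)]
    rwa [coeff_degreeSlice _ _ (Nat.zero_le _)] at hbot
  · have hd : q.derivative.eval z = h.derivative.eval (z + s) := by
      simp [hqc, Polynomial.derivative_comp]
    rw [hd]
    exact hsimple _ (by simpa [hqc] using hz)
end
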